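/- arXiv:1501.01999 — 2 statements merged into one kernel-verified Lean document; each statement's English description precedes it below -/
import Mathlib

section
/- Let f* : D → C be a coproduct-preserving tensor-exact functor between rigidly-compactly generated tensor-triangulated categories, with adjoints f* ⊣ f_* ⊣ f^(1), and let κ ∈ D. Set κ' := f^(1)(κ). Then the internal adjunction isomorphism hom_D(f_* x, κ) ≅ f_* hom_C(x, f^(1) κ) yields a canonical natural isomorphism ζ : D_κ ∘ f_* ≅ f_* ∘ D_{κ'}, and this isomorphism is compatible with the canonical double-duality maps: for every x ∈ C the square formed by ϖ_{f_*(x)} : f_*(x) → D_κ D_κ f_*(x), f_*(ϖ_x) : f_*(x) → f_* D_{κ'} D_{κ'}(x), ζ at D_{κ'}(x), and D_κ(ζ) commutes. In other words, (f_*, ζ) is a duality-preserving functor from (C, D_{κ'}) to (D, D_κ). -/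
/-!
Formalization of statements from "Grothendieck-Neeman duality and the
Wirthmüller isomorphism" by Balmer, Dell'Ambrogio and Sanders.
-/

noncomputable section

open CategoryTheory CategoryTheory.Limits CategoryTheory.Pretriangulated
  CategoryTheory.MonoidalCategory CategoryTheory.MonoidalClosed Opposite

universe v u u₁ u₂ u₃

namespace GN

section Compact

variable {C : Type u} [Category.{v} C]

/-- An object `t` is compact if `Hom(t, -)`, viewed as a functor to abelian groups,
preserves small coproducts. -/
def IsCompactObj [Preadditive C] (t : C) : Prop :=
  ∀ J : Type v, Nonempty (PreservesColimitsOfShape (Discrete J)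
    (preadditiveCoyoneda.obj (op t)))

/-- A functor preserves arbitrary (small) coproducts. -/
def PreservesCoproducts {D : Type u₂} [Category.{v} D] (F : C ⥤ D) : Prop :=
  ∀ J : Type v, Nonempty (PreservesColimitsOfShape (Discrete J) F)

/-- A functor preserves arbitrary (small) products. -/
def PreservesProducts {D : Type u₂} [Category.{v} D] (F : C ⥤ D) : Prop :=
  ∀ J : Type v, Nonempty (PreservesLimitsOfShape (Discrete J) F)

/-- A compactly generated category: it admits all small coproducts and
has a set of compact generators. -/
structure CompactlyGenerated (C : Type u) [Category.{v} C] [Preadditive C] : Prop where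
  hasCoproducts : HasCoproducts.{v} C
  exists_generators : ∃ (ι : Type v) (G : ι → C), (∀ i, IsCompactObj (G i)) ∧
    ∀ t : C, (∀ (i : ι) (f : G i ⟶ t), f = 0) → IsZero t

end Compact

section Tensor

variable {C : Type u} [Category.{v} C] [MonoidalCategory C] [MonoidalClosed C]

/-- The canonical map `hom(x,𝟙) ⊗ y ⟶ hom(x,y)`. -/
def rigidComparison (x y : C) : (ihom x).obj (𝟙_ C) ⊗ y ⟶ (ihom x).obj y :=
  MonoidalClosed.curry ((α_ x ((ihom x).obj (𝟙_ C)) y).inv ≫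
    (((ihom.ev x).app (𝟙_ C)) ▷ y) ≫ (λ_ y).hom)

/-- An object `x` is rigid if `hom(x,𝟙) ⊗ y ⟶ hom(x,y)` is an isomorphism for all `y`. -/
def IsRigid (x : C) : Prop := ∀ y : C, IsIso (rigidComparison x y)

/-- An object `u` is `⊗`-invertible if `u ⊗ v ≅ 𝟙` for some `v`. -/
def TensorInvertible (u : C) : Prop := ∃ v : C, Nonempty (u ⊗ v ≅ 𝟙_ C)

/-- The `κ`-twisted duality functor `D_κ = hom(-,κ)`. -/
@[reducible] def Dfun (κ : C) : Cᵒᵖ ⥤ C := MonoidalClosed.internalHom.flip.obj κ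

/-- The canonical double-duality map `ϖ : x ⟶ D_κ D_κ (x)`, i.e. the unit/counit of the
self-adjunction of `D_κ = hom(-,κ)`. -/
def varpi [BraidedCategory C] (κ x : C) : x ⟶ (ihom ((ihom x).obj κ)).obj κ :=
  MonoidalClosed.curry ((β_ ((ihom x).obj κ) x).hom ≫ (ihom.ev x).app κ)

/-- A rigidly-compactly generated tensor-triangulated category: it admits all small
coproducts, its compact objects coincide with its rigid objects, and it has a set of
compact generators. -/
structure RigidlyCompactlyGenerated (C : Type u) [Category.{v} C] [Preadditive C]
    [MonoidalCategory C] [MonoidalClosed C] : Prop where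
  hasCoproducts : HasCoproducts.{v} C
  compact_iff_rigid : ∀ x : C, IsCompactObj x ↔ IsRigid x
  exists_generators : ∃ (ι : Type v) (G : ι → C), (∀ i, IsCompactObj (G i)) ∧
    ∀ t : C, (∀ (i : ι) (f : G i ⟶ t), f = 0) → IsZero t

end Tensor

section Triang

variable {C : Type u} [Category.{v} C] [HasZeroObject C] [Preadditive C] [HasShift C ℤ]
  [∀ n : ℤ, (shiftFunctor C n).Additive] [Pretriangulated C]

/-- A thick triangulated subcategory, given as a predicate on objects:
it contains the zero objects, and is closed under shifts, cones and direct summands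
(hence in particular under isomorphisms). -/
structure IsThickSubcategory (S : Set C) : Prop where
  zero : ∀ x : C, IsZero x → x ∈ S
  shift : ∀ x ∈ S, ∀ n : ℤ, x⟦n⟧ ∈ S
  ext₃ : ∀ T : Triangle C, (T ∈ distTriang C) → T.obj₁ ∈ S → T.obj₂ ∈ S → T.obj₃ ∈ S
  retract : ∀ x y : C, (∃ (s : x ⟶ y) (r : y ⟶ x), s ≫ r = 𝟙 x) → y ∈ S → x ∈ S

/-- The thick subcategory generated by a set of objects. -/
def thickClosure (S : Set C) : Set C :=
  { x | ∀ T : Set C, IsThickSubcategory T → S ⊆ T → x ∈ T }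

/-- A `C^c`-submodule of `C`: a thick triangulated subcategory which is closed under
tensoring with compact objects. -/
structure IsSubmodule [MonoidalCategory C] (S : Set C) extends IsThickSubcategory S : Prop where
  smul : ∀ c x : C, IsCompactObj c → x ∈ S → (c ⊗ x) ∈ S

end Triang

section Dual

variable {C : Type u} [Category.{v} C] [MonoidalCategory C] [BraidedCategory C]
  [MonoidalClosed C]

/-- `κ` is a (possibly external) dualizing object for `S ⊆ C`: the `κ`-twisted
duality `D_κ = hom(-,κ)` preserves `S` and every object of `S` is `κ`-reflexive;
equivalently, `D_κ` restricts to an anti-equivalence `S^op ≃ S`. -/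
structure IsExternalDualizing (S : Set C) (κ : C) : Prop where
  stable : ∀ x ∈ S, (ihom x).obj κ ∈ S
  reflexive : ∀ x ∈ S, IsIso (varpi κ x)

/-- `κ ∈ S` is a dualizing object for `S`. -/
structure IsDualizing (S : Set C) (κ : C) extends IsExternalDualizing S κ : Prop where
  mem : κ ∈ S

end Dual

section Pullback

variable {C : Type u₁} {D : Type u₂} [Category.{v} C] [Category.{v} D]
  [Preadditive C] [MonoidalCategory C]

/-- The compact pull-back `f^#(D₀)` of a subcategory `D₀ ⊆ D` along `f_* : C ⥤ D`. -/
def compactPullback (fpush : C ⥤ D) (D₀ : Set D) : Set C :=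
  { x | ∀ c : C, IsCompactObj c → fpush.obj (c ⊗ x) ∈ D₀ }

end Pullback

section Proj

variable {D : Type u₁} {C : Type u₂} [Category.{v} D] [Category.{v} C]
  [MonoidalCategory D] [MonoidalCategory C]

/-- The canonical projection formula map `π : x ⊗ f_*(y) ⟶ f_*(f^*(x) ⊗ y)`,
obtained by adjunction from `f^*(x ⊗ f_* y) ≅ f^* x ⊗ f^* f_* y → f^* x ⊗ y`. -/
def projFormula (fstar : D ⥤ C) [fstar.Monoidal] (fpush : C ⥤ D) (adj : fstar ⊣ fpush)
    (x : D) (y : C) : x ⊗ fpush.obj y ⟶ fpush.obj (fstar.obj x ⊗ y) :=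
  (adj.homEquiv _ _)
    (Functor.OplaxMonoidal.δ fstar x (fpush.obj y) ≫ (fstar.obj x ◁ adj.counit.app y))

/-- The canonical comparison map `f^(1)(x) ⊗ f^*(y) ⟶ f^(1)(x ⊗ y)`, obtained by
adjunction from the counit `f_* f^(1) → Id` via the projection formula. -/
def gnComparison [BraidedCategory D] [BraidedCategory C] (fstar : D ⥤ C) [fstar.Monoidal]
    (fpush : C ⥤ D) (adj1 : fstar ⊣ fpush) (fone : D ⥤ C) (adj2 : fpush ⊣ fone)
    (hπ : ∀ (x : D) (y : C), IsIso (projFormula fstar fpush adj1 x y)) (x y : D) :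
    fone.obj x ⊗ fstar.obj y ⟶ fone.obj (x ⊗ y) :=
  haveI := hπ y (fone.obj x)
  (adj2.homEquiv _ _)
    (fpush.map (β_ (fone.obj x) (fstar.obj y)).hom ≫
      inv (projFormula fstar fpush adj1 y (fone.obj x)) ≫
      (β_ y (fpush.obj (fone.obj x))).hom ≫ (adj2.counit.app x ▷ y))

end Proj

section CompactDetection

variable {C : Type u} [Category.{v} C] [Preadditive C]

lemma IsCompactObj.shift [HasShift C ℤ] [∀ n : ℤ, (shiftFunctor C n).Additive] {t : C}
    (ht : IsCompactObj t) (n : ℤ) : IsCompactObj (t⟦n⟧) := by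
  intro J
  obtain ⟨_⟩ := ht J
  let adj := (shiftEquiv C n).toAdjunction
  let e : preadditiveCoyoneda.obj (op (t⟦n⟧)) ≅
      (shiftEquiv C n).inverse ⋙ preadditiveCoyoneda.obj (op t) :=
    NatIso.ofComponents
      (fun X => AddEquiv.toAddCommGrpIso
        { adj.homEquiv t X with
          map_add' := fun a b => by
            have hadd (s : t ⟶ t⟦n⟧⟦-n⟧) (a b : t⟦n⟧ ⟶ X) :
                s ≫ (shiftFunctor C (-n)).map (a + b) =
                  s ≫ (shiftFunctor C (-n)).map a + s ≫ (shiftFunctor C (-n)).map b := by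
              rw [Functor.map_add, Preadditive.comp_add]
            exact hadd (adj.unit.app t) a b })
      (fun {X Y} f => by
        ext a
        exact adj.homEquiv_naturality_right a f)
  exact ⟨preservesColimitsOfShape_of_natIso e.symm⟩

/-- In a triangulated category with a set of compact generators, isomorphisms are detected by
mapping out of compact objects. -/
lemma isIso_of_bijective_of_isCompactObj [HasZeroObject C] [HasShift C ℤ]
    [∀ n : ℤ, (shiftFunctor C n).Additive] [Pretriangulated C]
    (hgen : ∃ (ι : Type v) (G : ι → C), (∀ i, IsCompactObj (G i)) ∧
      ∀ t : C, (∀ (i : ι) (f : G i ⟶ t), f = 0) → IsZero t)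
    {X Y : C} (φ : X ⟶ Y)
    (hφ : ∀ c : C, IsCompactObj c → Function.Bijective (fun a : c ⟶ X => a ≫ φ)) :
    IsIso φ := by
  obtain ⟨ι, G, hG, hzero⟩ := hgen
  obtain ⟨Z, g, h, hT⟩ := distinguished_cocone_triangle φ
  refine (Triangle.isZero₃_iff_isIso₁ _ hT).1 (hzero Z fun i f => ?_)
  have hinj : ∀ b : G i ⟶ X⟦(1 : ℤ)⟧, b ≫ φ⟦(1 : ℤ)⟧' = 0 → b = 0 := by
    intro b hb
    let adj := (shiftEquiv C (1 : ℤ)).symm.toAdjunction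
    apply (adj.homEquiv (G i) X).symm.injective
    apply (hφ _ ((hG i).shift (-1))).1
    have hnat := adj.homEquiv_naturality_right_symm b φ
    have hnat' := adj.homEquiv_naturality_right_symm (0 : G i ⟶ X⟦(1 : ℤ)⟧) φ
    refine hnat.symm.trans (Eq.trans ?_ hnat')
    exact congrArg _ (hb.trans zero_comp.symm)
  have hfh : f ≫ h = 0 := by
    apply hinj
    have : h ≫ φ⟦(1 : ℤ)⟧' = 0 := comp_distTriang_mor_zero₃₁ _ hT
    rw [Category.assoc, this, comp_zero]
  obtain ⟨a, rfl⟩ : ∃ a : G i ⟶ Y, f = a ≫ g := Triangle.coyoneda_exact₃ _ hT f hfh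
  obtain ⟨b, rfl⟩ := (hφ _ (hG i)).2 a
  have : φ ≫ g = 0 := comp_distTriang_mor_zero₁₂ _ hT
  simp [this]

end CompactDetection

section RigidPairing

variable {C : Type u} [Category.{v} C] [MonoidalCategory C]

lemma whiskerLeft_zigzag_comp_eval {x d : C} (c : 𝟙_ C ⟶ d ⊗ x) (e : x ⊗ d ⟶ 𝟙_ C)
    (hc : x ◁ c ≫ (α_ _ _ _).inv ≫ e ▷ x = (ρ_ x).hom ≫ (λ_ x).inv) :
    x ◁ (c ▷ d ≫ (α_ _ _ _).hom ≫ d ◁ e ≫ (ρ_ d).hom) ≫ e = x ◁ (λ_ d).hom ≫ e := by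
  calc
    _ = 𝟙 _ ⊗≫ x ◁ c ▷ d ⊗≫ ((x ⊗ d) ◁ e ≫ e ▷ (𝟙_ C)) ⊗≫ 𝟙 _ := by
      monoidal
    _ = 𝟙 _ ⊗≫ (x ◁ c ≫ (α_ _ _ _).inv ≫ e ▷ x) ▷ d ⊗≫ e := by
      rw [whisker_exchange]; monoidal
    _ = _ := by
      rw [hc]; monoidal

/-- A rigid object `x` is dual to `hom(x,𝟙)`. -/
@[reducible]
def IsRigid.exactPairing [MonoidalClosed C] {x : C} (hx : IsRigid x) :
    ExactPairing ((ihom x).obj (𝟙_ C)) x :=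
  haveI := hx x
  have hc : x ◁ (MonoidalClosed.curry (ρ_ x).hom ≫ inv (rigidComparison x x)) ≫ (α_ _ _ _).inv ≫
      (ihom.ev x).app (𝟙_ C) ▷ x = (ρ_ x).hom ≫ (λ_ x).inv := by
    have h : (MonoidalClosed.curry (ρ_ x).hom ≫ inv (rigidComparison x x)) ≫
        rigidComparison x x = MonoidalClosed.curry (ρ_ x).hom := by simp
    rw [← cancel_mono (λ_ x).hom]
    simpa using curry_injective ((curry_natural_left _ _).trans h)
  { coevaluation' := MonoidalClosed.curry (ρ_ x).hom ≫ inv (rigidComparison x x)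
    evaluation' := (ihom.ev x).app (𝟙_ C)
    coevaluation_evaluation' := hc
    evaluation_coevaluation' := by
      rw [← cancel_mono (ρ_ _).hom]
      apply uncurry_injective
      simpa only [uncurry_eq, Category.assoc, Iso.inv_hom_id, Category.comp_id] using
        whiskerLeft_zigzag_comp_eval _ _ hc }

end RigidPairing

section PushForward

variable {D : Type u₁} {C : Type u₂} [Category.{v} D] [Category.{v} C]
  [MonoidalCategory D] [MonoidalCategory C]

open Functor.LaxMonoidal Functor.OplaxMonoidal

/-- The projection formula map `f_*(x) ⊗ y ⟶ f_*(x ⊗ f^*(y))`, with the roles of the two factors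
of `projFormula` exchanged. -/
def projFormulaRight {fstar : D ⥤ C} {fpush : C ⥤ D} (adj : fstar ⊣ fpush)
    [fpush.LaxMonoidal] (x : C) (y : D) : fpush.obj x ⊗ y ⟶ fpush.obj (x ⊗ fstar.obj y) :=
  fpush.obj x ◁ adj.unit.app y ≫ μ fpush x (fstar.obj y)

variable {fstar : D ⥤ C} {fpush : C ⥤ D} (adj : fstar ⊣ fpush) [fpush.LaxMonoidal]

lemma homEquiv_symm_projFormulaRight [fstar.Monoidal] [adj.IsMonoidal] (x : C) (y : D) :
    (adj.homEquiv _ _).symm (projFormulaRight adj x y) =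
      δ fstar (fpush.obj x) y ≫ adj.counit.app x ▷ fstar.obj y := by
  rw [projFormulaRight, Adjunction.homEquiv_counit, Functor.map_comp, Category.assoc,
    adj.map_μ_comp_counit_app_tensor]
  have h := δ_natural_right fstar (fpush.obj x) (adj.unit.app y)
  dsimp at h
  rw [← reassoc_of% h, tensorHom_def', ← MonoidalCategory.whiskerLeft_comp_assoc]
  simp

lemma map_tensorRightHomEquiv_comp_δ [fstar.Monoidal] {y' y : D} [ExactPairing y' y]
    (z w : D) (g : z ⊗ y' ⟶ w) :
    fstar.map (tensorRightHomEquiv z y' y w g) ≫ δ fstar w y =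
      (ρ_ _).inv ≫ fstar.obj z ◁ (Functor.LaxMonoidal.ε fstar ≫ fstar.map (η_ y' y) ≫
        δ fstar y' y) ≫ (α_ _ _ _).inv ≫ (μ fstar z y' ≫ fstar.map g) ▷ fstar.obj y := by
  simp [tensorRightHomEquiv]

/-- The image of an exact pairing under a monoidal functor. -/
@[reducible]
def exactPairingMap (F : D ⥤ C) [F.Monoidal] (y' y : D) [ExactPairing y' y] :
    ExactPairing (F.obj y') (F.obj y) where
  coevaluation' := Functor.LaxMonoidal.ε F ≫ F.map (η_ y' y) ≫ δ F y' y
  evaluation' := μ F y y' ≫ F.map (ε_ y' y) ≫ Functor.OplaxMonoidal.η F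
  coevaluation_evaluation' := by
    have h := congrArg F.map (ExactPairing.coevaluation_evaluation y' y).symm
    simp only [Functor.map_comp] at h
    simp [reassoc_of% h]
    simp only [Functor.Monoidal.map_whiskerLeft, Functor.Monoidal.map_whiskerRight,
      Functor.Monoidal.map_associator_inv, Category.assoc, Functor.Monoidal.μ_δ_assoc]
  evaluation_coevaluation' := by
    have h := congrArg F.map (ExactPairing.evaluation_coevaluation y' y).symm
    simp only [Functor.map_comp] at h
    simp [reassoc_of% h]
    simp only [Functor.Monoidal.map_whiskerLeft, Functor.Monoidal.map_whiskerRight,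
      Functor.Monoidal.map_associator, Category.assoc, Functor.Monoidal.μ_δ_assoc]

lemma isIso_projFormulaRight [fstar.Monoidal] [adj.IsMonoidal] {y' y : D}
    [ExactPairing y' y] (x : C) :
    IsIso (projFormulaRight adj x y) := by
  let := exactPairingMap fstar y' y
  refine isIso_of_yoneda_map_bijective _ fun z => ?_
  let e : (z ⟶ fpush.obj x ⊗ y) ≃ (z ⟶ fpush.obj (x ⊗ fstar.obj y)) :=
    (tensorRightHomEquiv z y' y (fpush.obj x)).symm.trans <|
      (adj.homEquiv _ _).symm.trans <|
      (Iso.homCongr (Functor.Monoidal.μIso fstar z y').symm (Iso.refl x)).trans <|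
      (tensorRightHomEquiv (fstar.obj z) (fstar.obj y') (fstar.obj y) x).trans <|
      adj.homEquiv _ _
  convert e.bijective using 1
  ext a
  obtain ⟨g, rfl⟩ := (tensorRightHomEquiv z y' y (fpush.obj x)).surjective a
  apply (adj.homEquiv _ _).symm.injective
  rw [adj.homEquiv_naturality_left_symm, homEquiv_symm_projFormulaRight,
    ← Category.assoc, map_tensorRightHomEquiv_comp_δ]
  simp only [e, Equiv.trans_apply, Equiv.symm_apply_apply]
  change _ = (ρ_ _).inv ≫ fstar.obj z ◁ (Functor.LaxMonoidal.ε fstar ≫ fstar.map (η_ y' y) ≫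
    δ fstar y' y) ≫ (α_ _ _ _).inv ≫ _ ▷ fstar.obj y
  simp [Adjunction.homEquiv_counit]

/-- The right adjoint of a braided monoidal functor is lax braided. -/
lemma map_braiding_of_isMonoidal [BraidedCategory D] [BraidedCategory C] {F : D ⥤ C} [F.Braided]
    {G : C ⥤ D} [G.LaxMonoidal] (adj : F ⊣ G) [adj.IsMonoidal] (x y : C) :
    μ G x y ≫ G.map (β_ x y).hom = (β_ (G.obj x) (G.obj y)).hom ≫ μ G y x := by
  apply (adj.homEquiv _ _).symm.injective
  simp only [Adjunction.homEquiv_counit, Functor.map_comp, Category.assoc,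
    adj.map_μ_comp_counit_app_tensor, Adjunction.counit_naturality]
  rw [reassoc_of% adj.map_μ_comp_counit_app_tensor x y]
  simp [Functor.map_braiding]

section Dual

variable [MonoidalClosed D] [MonoidalClosed C] {fone : D ⥤ C} (adj₂ : fpush ⊣ fone)

/-- The canonical map `f_* hom(x, f^(1) κ) ⟶ hom(f_* x, κ)`. -/
def dualComparison (κ : D) (x : C) :
    fpush.obj ((ihom x).obj (fone.obj κ)) ⟶ (ihom (fpush.obj x)).obj κ :=
  MonoidalClosed.curry (μ fpush x ((ihom x).obj (fone.obj κ)) ≫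
    fpush.map ((ihom.ev x).app (fone.obj κ)) ≫ adj₂.counit.app κ)

lemma uncurry_dualComparison (κ : D) (x : C) :
    MonoidalClosed.uncurry (dualComparison adj₂ κ x) =
      μ fpush x ((ihom x).obj (fone.obj κ)) ≫
        fpush.map ((ihom.ev x).app (fone.obj κ)) ≫ adj₂.counit.app κ :=
  uncurry_curry _

lemma dualComparison_naturality (κ : D) {x x' : C} (f : x ⟶ x') :
    fpush.map ((MonoidalClosed.pre f).app (fone.obj κ)) ≫ dualComparison adj₂ κ x =
      dualComparison adj₂ κ x' ≫ (MonoidalClosed.pre (fpush.map f)).app κ := by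
  apply uncurry_injective
  rw [uncurry_natural_left, uncurry_dualComparison, uncurry_pre_app, uncurry_dualComparison,
    μ_natural_right_assoc, μ_natural_left_assoc, ← Functor.map_comp_assoc,
    ← Functor.map_comp_assoc, id_tensor_pre_app_comp_ev]

lemma uncurry_homEquiv_comp_dualComparison (κ : D) (x : C) (y : D)
    (t : fstar.obj y ⟶ (ihom x).obj (fone.obj κ)) :
    MonoidalClosed.uncurry (adj.homEquiv _ _ t ≫ dualComparison adj₂ κ x) =
      projFormulaRight adj x y ≫ (adj₂.homEquiv _ _).symm (MonoidalClosed.uncurry t) := by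
  rw [uncurry_natural_left, uncurry_dualComparison, Adjunction.homEquiv_unit, projFormulaRight,
    uncurry_eq, Adjunction.homEquiv_counit]
  simp

lemma bijective_comp_dualComparison (κ : D) (x : C) (y : D) [IsIso (projFormulaRight adj x y)] :
    Function.Bijective
      (fun a : y ⟶ fpush.obj ((ihom x).obj (fone.obj κ)) => a ≫ dualComparison adj₂ κ x) := by
  let e : (y ⟶ fpush.obj ((ihom x).obj (fone.obj κ))) ≃ (y ⟶ (ihom (fpush.obj x)).obj κ) :=
    (adj.homEquiv _ _).symm.trans <|
      ((ihom.adjunction x).homEquiv _ _).symm.trans <|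
      (adj₂.homEquiv _ _).symm.trans <|
      (Iso.homCongr (asIso (projFormulaRight adj x y)).symm (Iso.refl κ)).trans <|
      (ihom.adjunction (fpush.obj x)).homEquiv _ _
  convert e.bijective using 1
  ext a
  obtain ⟨t, rfl⟩ := (adj.homEquiv _ _).surjective a
  apply uncurry_injective
  rw [uncurry_homEquiv_comp_dualComparison]
  simp only [e, Equiv.trans_apply, Equiv.symm_apply_apply]
  refine Eq.trans ?_ (uncurry_curry _).symm
  simp
  rfl

lemma varpi_comp_pre_dualComparison [BraidedCategory D] [BraidedCategory C]
    (hβ : ∀ x y : C, μ fpush x y ≫ fpush.map (β_ x y).hom =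
      (β_ (fpush.obj x) (fpush.obj y)).hom ≫ μ fpush y x) (κ : D) (x : C) :
    varpi κ (fpush.obj x) ≫ (MonoidalClosed.pre (dualComparison adj₂ κ x)).app κ =
      fpush.map (varpi (fone.obj κ) x) ≫
        dualComparison adj₂ κ ((ihom x).obj (fone.obj κ)) := by
  apply uncurry_injective
  rw [uncurry_pre_app, uncurry_natural_left, uncurry_dualComparison, varpi, uncurry_curry,
    BraidedCategory.braiding_naturality_left_assoc, ← uncurry_eq, uncurry_dualComparison,
    μ_natural_right_assoc, ← Functor.map_comp_assoc, ← uncurry_eq, varpi, uncurry_curry,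
    Functor.map_comp, Category.assoc, reassoc_of% hβ]

end Dual

end PushForward

/-- Theorem 5.15: `f_*` is a duality-preserving functor. -/
theorem statement13 {D : Type u₁} {C : Type u₂}
    [Category.{v} D] [Preadditive D] [HasZeroObject D] [HasShift D ℤ]
    [∀ n : ℤ, (shiftFunctor D n).Additive] [Pretriangulated D] [IsTriangulated D]
    [MonoidalCategory D] [SymmetricCategory D] [MonoidalClosed D]
    [Category.{v} C] [Preadditive C] [HasZeroObject C] [HasShift C ℤ]
    [∀ n : ℤ, (shiftFunctor C n).Additive] [Pretriangulated C] [IsTriangulated C]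
    [MonoidalCategory C] [SymmetricCategory C] [MonoidalClosed C]
    (fstar : D ⥤ C) [fstar.Braided] [fstar.CommShift ℤ] [fstar.IsTriangulated]
    (hD : RigidlyCompactlyGenerated D) (hC : RigidlyCompactlyGenerated C)
    (hcop : PreservesCoproducts fstar)
    (fpush : C ⥤ D) (adj1 : fstar ⊣ fpush)
    (fone : D ⥤ C) (adj2 : fpush ⊣ fone)
    (κ : D) :
    ∃ ζ : (fpush.op ⋙ Dfun κ) ≅ (Dfun (fone.obj κ) ⋙ fpush),
      ∀ x : C,
        varpi κ (fpush.obj x) ≫ (Dfun κ).map ((ζ.inv.app (op x)).op) =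
        fpush.map (varpi (fone.obj κ) x) ≫ ζ.inv.app (op ((ihom x).obj (fone.obj κ))) := by
  let := adj1.rightAdjointLaxMonoidal
  have hiso (x : C) : IsIso (dualComparison adj2 κ x) :=
    isIso_of_bijective_of_isCompactObj hD.exists_generators _ fun y hy => by
      let := ((hD.compact_iff_rigid y).1 hy).exactPairing
      have := isIso_projFormulaRight adj1 (y' := (ihom y).obj (𝟙_ D)) (y := y) x
      exact bijective_comp_dualComparison adj1 adj2 κ x y
  let ζ : Dfun (fone.obj κ) ⋙ fpush ≅ fpush.op ⋙ Dfun κ :=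
    NatIso.ofComponents (fun x : Cᵒᵖ => @asIso _ _ _ _ (dualComparison adj2 κ x.unop) (hiso x.unop))
      fun f => dualComparison_naturality adj2 κ f.unop
  refine ⟨ζ.symm, fun x => ?_⟩
  exact varpi_comp_pre_dualComparison adj2 (map_braiding_of_isMonoidal adj1) κ x

end GN
end
end

section
/- Let f* : D → C be a coproduct-preserving tensor-exact functor between rigidly-compactly generated tensor-triangulated categories, with adjoints f* ⊣ f_* ⊣ f^(1). Let D₀ ⊆ D be a D^c-submodule equipped with a dualizing object κ ∈ D₀, and set κ' := f^(1)(κ). Consider, for x ∈ C, the properties: (i) x ∈ f^#(D₀); (ii) x is κ'-reflexive, i.e. the canonical map ϖ : x → D_{κ'} D_{κ'}(x) is an isomorphism. Then: (a) if 𝟙 ∈ D₀, then (i) implies (ii); (b) if D₀ consists precisely of the κ-reflexive objects of D, then (ii) implies (i). -/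
/-!
Formalization of statements from "Grothendieck-Neeman duality and the
Wirthmüller isomorphism" by Balmer, Dell'Ambrogio and Sanders.
-/

noncomputable section

open CategoryTheory CategoryTheory.Limits CategoryTheory.Pretriangulated
  CategoryTheory.MonoidalCategory CategoryTheory.MonoidalClosed Opposite

universe v u u₁ u₂ u₃

namespace GN

section Bijective

variable {C : Type u} [Category.{v} C]

lemma bijective_precomp {a b : C} (f : a ⟶ b) [IsIso f] (z : C) :
    Function.Bijective fun g : b ⟶ z => f ≫ g :=
  (asIso f).symm.homFromEquiv.bijective

lemma bijective_postcomp {a b : C} (f : a ⟶ b) [IsIso f] (z : C) :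
    Function.Bijective fun g : z ⟶ a => g ≫ f :=
  (asIso f).homToEquiv.bijective

lemma isIso_of_bijective_postcomp {a b : C} (f : a ⟶ b)
    (h : ∀ t : C, Function.Bijective fun g : t ⟶ a => g ≫ f) : IsIso f := by
  obtain ⟨g, hg⟩ := (h b).2 (𝟙 b)
  exact ⟨g, (h a).1 (by simp at hg; simp [hg]), hg⟩

end Bijective

section Pairings

variable {C : Type u} [Category.{v} C] [MonoidalCategory C]

/-- A pairing `p : x ⊗ y ⟶ k` is left dual at `t` if it induces a bijection
`Hom(t, y) ≃ Hom(x ⊗ t, k)`. -/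
def LeftDualAt {x y k : C} (p : x ⊗ y ⟶ k) (t : C) : Prop :=
  Function.Bijective fun g : t ⟶ y => x ◁ g ≫ p

/-- A pairing `p : x ⊗ y ⟶ k` is right dual at `t` if it induces a bijection
`Hom(t, x) ≃ Hom(t ⊗ y, k)`. -/
def RightDualAt {x y k : C} (p : x ⊗ y ⟶ k) (t : C) : Prop :=
  Function.Bijective fun g : t ⟶ x => g ▷ y ≫ p

lemma RightDualAt.of_iso {x y k : C} {p : x ⊗ y ⟶ k} {t t' : C} (e : t ≅ t')
    (h : RightDualAt p t) : RightDualAt p t' := by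
  have h' : (fun g : t' ⟶ x => g ▷ y ≫ p) =
      (fun g => e.inv ▷ y ≫ g) ∘ (fun g : t ⟶ x => g ▷ y ≫ p) ∘ fun g => e.hom ≫ g := by
    ext g
    simp
  rw [RightDualAt, h']
  exact (bijective_precomp _ _).comp (h.comp (bijective_precomp _ _))

/-- The pairing `(x ⊗ c) ⊗ (c' ⊗ y) ⟶ k` obtained from a pairing `p : x ⊗ y ⟶ k` by contracting
an exact pairing of `c'` and `c`. -/
def contractPairing {x y k : C} (p : x ⊗ y ⟶ k) (c' c : C) [ExactPairing c' c] :
    (x ⊗ c) ⊗ (c' ⊗ y) ⟶ k :=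
  (α_ x c (c' ⊗ y)).hom ≫ x ◁ ((α_ c c' y).inv ≫ ε_ c' c ▷ y ≫ (λ_ y).hom) ≫ p

lemma leftDualAt_contractPairing_iff {x y k : C} (p : x ⊗ y ⟶ k) (c' c t : C)
    [ExactPairing c' c] :
    LeftDualAt (contractPairing p c' c) t ↔ LeftDualAt p (c ⊗ t) := by
  have h : (fun g : t ⟶ c' ⊗ y => (x ⊗ c) ◁ g ≫ contractPairing p c' c) =
      (fun g => (α_ x c t).hom ≫ g) ∘ (fun g : c ⊗ t ⟶ y => x ◁ g ≫ p) ∘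
        (tensorLeftHomEquiv t c' c y).symm := by
    ext g
    simp [contractPairing, tensorLeftHomEquiv]
  rw [LeftDualAt, h, Function.Bijective.of_comp_iff' (bijective_precomp _ _),
    Function.Bijective.of_comp_iff _ (Equiv.bijective _), LeftDualAt]

lemma rightDualAt_contractPairing_iff {x y k : C} (p : x ⊗ y ⟶ k) (c' c t : C)
    [ExactPairing c' c] :
    RightDualAt (contractPairing p c' c) t ↔ RightDualAt p (t ⊗ c') := by
  have h : (fun g : t ⟶ x ⊗ c => g ▷ (c' ⊗ y) ≫ contractPairing p c' c) =
      (fun g => (α_ t c' y).inv ≫ g) ∘ (fun g : t ⊗ c' ⟶ x => g ▷ y ≫ p) ∘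
        (tensorRightHomEquiv t c' c x).symm := by
    ext g
    simp [contractPairing, tensorRightHomEquiv]
  rw [RightDualAt, h, Function.Bijective.of_comp_iff' (bijective_precomp _ _),
    Function.Bijective.of_comp_iff _ (Equiv.bijective _), RightDualAt]

lemma rightDualAt_iff_leftDualAt_braiding [BraidedCategory C] {x y k : C} (p : x ⊗ y ⟶ k) (t : C) :
    RightDualAt p t ↔ LeftDualAt ((β_ y x).hom ≫ p) t := by
  have h : (fun g : t ⟶ x => y ◁ g ≫ (β_ y x).hom ≫ p) =
      (fun g => (β_ y t).hom ≫ g) ∘ fun g : t ⟶ x => g ▷ y ≫ p := by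
    ext g
    simp
  rw [LeftDualAt, h, Function.Bijective.of_comp_iff' (bijective_precomp _ _), RightDualAt]

variable [MonoidalClosed C]

lemma leftDualAt_iff {x y k : C} (p : x ⊗ y ⟶ k) (t : C) :
    LeftDualAt p t ↔ Function.Bijective fun g : t ⟶ y => g ≫ MonoidalClosed.curry p := by
  have h : (fun g : t ⟶ y => g ≫ MonoidalClosed.curry p) =
      ((ihom.adjunction x).homEquiv t k) ∘ fun g : t ⟶ y => x ◁ g ≫ p := by
    ext g
    exact (MonoidalClosed.curry_natural_left g p).symm
  rw [h, Function.Bijective.of_comp_iff' (Equiv.bijective _), LeftDualAt]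

lemma forall_leftDualAt_iff {x y k : C} (p : x ⊗ y ⟶ k) :
    (∀ t, LeftDualAt p t) ↔ IsIso (MonoidalClosed.curry p) := by
  simp only [leftDualAt_iff]
  exact ⟨isIso_of_bijective_postcomp _, fun _ _ => bijective_postcomp _ _⟩

lemma leftDualAt_ev (x k t : C) : LeftDualAt ((ihom.ev x).app k) t := by
  refine (forall_leftDualAt_iff _).2 ?_ t
  rw [← MonoidalClosed.uncurry_id_eq_ev, MonoidalClosed.curry_uncurry]
  infer_instance

lemma isIso_varpi_iff [BraidedCategory C] {x y k : C} (p : x ⊗ y ⟶ k) (hp : ∀ t, LeftDualAt p t) :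
    IsIso (varpi k x) ↔ ∀ t, RightDualAt p t := by
  have := (forall_leftDualAt_iff p).1 hp
  rw [varpi, ← forall_leftDualAt_iff]
  refine forall_congr' fun t => ?_
  rw [← rightDualAt_iff_leftDualAt_braiding]
  have h : (fun g : t ⟶ x => g ▷ y ≫ p) =
      (fun g => t ◁ MonoidalClosed.curry p ≫ g) ∘
        fun g : t ⟶ x => g ▷ (ihom x).obj k ≫ (ihom.ev x).app k := by
    ext g
    dsimp
    rw [whisker_exchange_assoc, ← MonoidalClosed.uncurry_eq, MonoidalClosed.uncurry_curry]
  rw [RightDualAt, RightDualAt, h, Function.Bijective.of_comp_iff'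
    (bijective_precomp _ _)]

end Pairings

section Rigid

variable {C : Type u} [Category.{v} C] [MonoidalCategory C]

lemma nonempty_exactPairing_of_bijective {c c' : C} (e : c ⊗ c' ⟶ 𝟙_ C)
    (h : ∀ t y : C, Function.Bijective fun g : t ⟶ c' ⊗ y =>
      c ◁ g ≫ (α_ c c' y).inv ≫ e ▷ y ≫ (λ_ y).hom) : Nonempty (ExactPairing c' c) := by
  obtain ⟨η, hη⟩ := (h (𝟙_ C) c).2 (ρ_ c).hom
  dsimp only at hη
  refine ⟨{ coevaluation' := η, evaluation' := e, coevaluation_evaluation' := ?_,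
            evaluation_coevaluation' := (h _ _).1 ?_ }⟩
  · rw [← hη]
    simp
  · calc
      _ = 𝟙 _ ⊗≫ c ◁ η ▷ c' ⊗≫ ((c ⊗ c') ◁ e ≫ e ▷ 𝟙_ C) ⊗≫ 𝟙 _ := by
        monoidal
      _ = 𝟙 _ ⊗≫ (c ◁ η ≫ (α_ c c' c).inv ≫ e ▷ c ≫ (λ_ c).hom) ▷ c' ⊗≫ e ⊗≫ 𝟙 _ := by
        rw [whisker_exchange]
        monoidal
      _ = _ := by
        rw [hη]
        monoidal

variable [MonoidalClosed C]

lemma IsRigid.nonempty_exactPairing {c : C} (hc : IsRigid c) :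
    Nonempty (ExactPairing ((ihom c).obj (𝟙_ C)) c) :=
  nonempty_exactPairing_of_bijective ((ihom.ev c).app (𝟙_ C))
    fun t y => (forall_leftDualAt_iff _).2 (hc y) t

lemma isRigid_of_exactPairing (c' c : C) [ExactPairing c' c] : IsRigid c := by
  have hc (y : C) : ∀ t, LeftDualAt ((α_ c c' y).inv ≫ ε_ c' c ▷ y ≫ (λ_ y).hom) t :=
    fun t => (tensorLeftHomEquiv t c' c y).symm.bijective
  have h₁ : ∀ t, LeftDualAt (ε_ c' c) t := fun t => by
    have h : (fun g : t ⟶ c' => c ◁ g ≫ ε_ c' c) =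
        (tensorLeftHomEquiv t c' c (𝟙_ C)).symm ∘ fun g : t ⟶ c' => g ≫ (ρ_ c').inv := by
      ext g
      simp [tensorLeftHomEquiv, unitors_equal]
    rw [LeftDualAt, h]
    exact (Equiv.bijective _).comp (bijective_postcomp _ _)
  have := (forall_leftDualAt_iff _).1 h₁
  intro y
  have h₂ := (forall_leftDualAt_iff _).1 (hc y)
  have h : MonoidalClosed.curry ((α_ c c' y).inv ≫ ε_ c' c ▷ y ≫ (λ_ y).hom) =
      MonoidalClosed.curry (ε_ c' c) ▷ y ≫ rigidComparison c y := by
    rw [rigidComparison, ← MonoidalClosed.curry_natural_left, associator_inv_naturality_middle_assoc,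
      ← comp_whiskerRight_assoc, ← MonoidalClosed.uncurry_eq, MonoidalClosed.uncurry_curry]
  rw [h] at h₂
  exact IsIso.of_isIso_comp_left (MonoidalClosed.curry (ε_ c' c) ▷ y) _

end Rigid

section Projection

variable {D : Type u₁} {C : Type u₂} [Category.{v} D] [Category.{v} C]
  [MonoidalCategory D] [MonoidalCategory C] (F : D ⥤ C)

open Functor.LaxMonoidal Functor.OplaxMonoidal Functor.Monoidal

/-- A monoidal functor preserves exact pairings. -/
@[reducible] def mapExactPairing [F.Monoidal] (t t' : D) [ExactPairing t t'] :
    ExactPairing (F.obj t) (F.obj t') where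
  coevaluation' := ε F ≫ F.map (η_ t t') ≫ δ F t t'
  evaluation' := μ F t' t ≫ F.map (ε_ t t') ≫ η F
  coevaluation_evaluation' := by
    have h := F.obj t' ◁ ε F ≫= μ F t' (𝟙_ D) ≫=
      (congrArg F.map (ExactPairing.coevaluation_evaluation t t') =≫
        (δ F (𝟙_ D) t' ≫ η F ▷ F.obj t'))
    simp only [Functor.map_comp, map_whiskerLeft, map_whiskerRight, map_associator_inv,
      map_rightUnitor, map_leftUnitor_inv, Category.assoc, μ_δ_assoc,
      whiskerRight_ε_η, whiskerLeft_ε_η_assoc, Category.comp_id] at h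
    simpa only [MonoidalCategory.whiskerLeft_comp, comp_whiskerRight, Category.assoc] using h
  evaluation_coevaluation' := by
    have h := ε F ▷ F.obj t ≫= μ F (𝟙_ D) t ≫=
      (congrArg F.map (ExactPairing.evaluation_coevaluation t t') =≫
        (δ F t (𝟙_ D) ≫ F.obj t ◁ η F))
    simp only [Functor.map_comp, map_whiskerLeft, map_whiskerRight, map_associator,
      map_leftUnitor, map_rightUnitor_inv, Category.assoc, μ_δ_assoc,
      whiskerLeft_ε_η, whiskerRight_ε_η_assoc, Category.comp_id] at h
    simpa only [MonoidalCategory.whiskerLeft_comp, comp_whiskerRight, Category.assoc] using h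

lemma isIso_projFormula [F.Monoidal] (G : C ⥤ D) (adj : F ⊣ G) (t t' : D) [ExactPairing t t']
    (y : C) : IsIso (projFormula F G adj t y) := by
  let _ := mapExactPairing F t t'
  refine isIso_of_bijective_postcomp _ fun s => ?_
  have h : (fun g : s ⟶ t ⊗ G.obj y => g ≫ projFormula F G adj t y) =
      (adj.homEquiv s _) ∘ (tensorLeftHomEquiv (F.obj s) (F.obj t) (F.obj t') y) ∘
        (fun g => μ F t' s ≫ g) ∘ (adj.homEquiv (t' ⊗ s) y).symm ∘
          (tensorLeftHomEquiv s t t' (G.obj y)).symm := by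
    ext g
    dsimp only [Function.comp]
    rw [← Equiv.symm_apply_eq, ← Equiv.symm_apply_eq, projFormula, adj.homEquiv_naturality_left_symm,
      Equiv.symm_apply_apply]
    have hε : ε_ (F.obj t) (F.obj t') = μ F t' t ≫ F.map (ε_ t t') ≫ η F := rfl
    simp only [tensorLeftHomEquiv, Equiv.coe_fn_symm_mk, adj.homEquiv_counit, hε,
      Functor.map_comp, map_whiskerLeft, map_whiskerRight, map_associator_inv, map_leftUnitor,
      MonoidalCategory.whiskerLeft_comp, comp_whiskerRight, Category.assoc, μ_δ_assoc]
    simp only [associator_inv_naturality_right_assoc, whisker_exchange_assoc,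
      id_whiskerLeft, Category.assoc, Iso.inv_hom_id, Category.comp_id]
  rw [h]
  exact (Equiv.bijective _).comp ((Equiv.bijective _).comp
    ((bijective_precomp _ _).comp ((Equiv.bijective _).comp (Equiv.bijective _))))

variable {F} {G : C ⥤ D} (adj : F ⊣ G) {H : D ⥤ C} (adj' : G ⊣ H)

/-- The pairing `G x ⊗ G y ⟶ k` induced by a pairing `x ⊗ y ⟶ H k`, for adjoints `F ⊣ G ⊣ H`
with `F` monoidal. -/
def pushPairing [F.Monoidal] {x y : C} {k : D} (p : x ⊗ y ⟶ H.obj k) : G.obj x ⊗ G.obj y ⟶ k :=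
  adj.homEquiv _ _ (δ F _ _ ≫ (adj.counit.app x ⊗ₘ adj.counit.app y)) ≫
    (adj'.homEquiv _ _).symm p

lemma rightDualAt_pushPairing_iff [F.Monoidal] {x y : C} {k : D} (p : x ⊗ y ⟶ H.obj k)
    (t t' : D) [ExactPairing t t'] :
    RightDualAt (pushPairing adj adj' p) t ↔ RightDualAt p (F.obj t) := by
  have := isIso_projFormula F G adj t t' y
  have h : (fun g : t ⟶ G.obj x => g ▷ G.obj y ≫ pushPairing adj adj' p) =
      (fun g => projFormula F G adj t y ≫ g) ∘ (adj'.homEquiv _ _).symm ∘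
        (fun g => g ▷ y ≫ p) ∘ (adj.homEquiv _ _).symm := by
    ext g
    dsimp only [Function.comp]
    rw [adj'.homEquiv_naturality_left_symm, pushPairing, ← Category.assoc, ← Category.assoc]
    congr 1
    apply (adj.homEquiv _ _).symm.injective
    rw [projFormula, adj.homEquiv_naturality_left_symm, adj.homEquiv_naturality_right_symm,
      Equiv.symm_apply_apply, Equiv.symm_apply_apply, ← δ_natural_left_assoc, Category.assoc,
      adj.homEquiv_counit, MonoidalCategory.tensorHom_def, comp_whiskerRight, ← whisker_exchange,
      ← whisker_exchange_assoc]
    rfl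
  rw [RightDualAt, h, Function.Bijective.of_comp_iff' (bijective_precomp _ _),
    Function.Bijective.of_comp_iff' (Equiv.bijective _),
    Function.Bijective.of_comp_iff _ (Equiv.bijective _), RightDualAt]

lemma leftDualAt_pushPairing_iff [BraidedCategory C] [BraidedCategory D] [F.Braided]
    {x y : C} {k : D} (p : x ⊗ y ⟶ H.obj k) (t t' : D) [ExactPairing t t'] :
    LeftDualAt (pushPairing adj adj' p) t ↔ LeftDualAt p (F.obj t) := by
  have := isIso_projFormula F G adj t t' x
  have h : (fun g : t ⟶ G.obj y => G.obj x ◁ g ≫ pushPairing adj adj' p) =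
      (fun g => ((β_ (G.obj x) t).hom ≫ projFormula F G adj t x ≫
        G.map (β_ x (F.obj t)).inv) ≫ g) ∘ (adj'.homEquiv _ _).symm ∘
        (fun g => x ◁ g ≫ p) ∘ (adj.homEquiv _ _).symm := by
    ext g
    dsimp only [Function.comp]
    rw [adj'.homEquiv_naturality_left_symm, pushPairing, ← Category.assoc, ← Category.assoc]
    congr 1
    apply (adj.homEquiv _ _).symm.injective
    rw [projFormula, Category.assoc, Category.assoc, ← G.map_comp, adj.homEquiv_naturality_left_symm,
      adj.homEquiv_naturality_left_symm, adj.homEquiv_naturality_right_symm,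
      Equiv.symm_apply_apply, Equiv.symm_apply_apply, ← δ_natural_right_assoc, Category.assoc,
      adj.homEquiv_counit, MonoidalCategory.tensorHom_def, MonoidalCategory.whiskerLeft_comp,
      Functor.map_braiding]
    simp [whisker_exchange_assoc]
  rw [LeftDualAt, h, Function.Bijective.of_comp_iff' (bijective_precomp _ _),
    Function.Bijective.of_comp_iff' (Equiv.bijective _),
    Function.Bijective.of_comp_iff _ (Equiv.bijective _), LeftDualAt]

end Projection

lemma exists_exactPairing {C : Type u} [Category.{v} C] [Preadditive C] [MonoidalCategory C]
    [BraidedCategory C] [MonoidalClosed C]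
    (hC : RigidlyCompactlyGenerated C) {c : C} (hc : IsCompactObj c) :
    ∃ c' : C, IsCompactObj c' ∧ Nonempty (ExactPairing c' c) ∧ Nonempty (ExactPairing c c') := by
  obtain ⟨_⟩ := ((hC.compact_iff_rigid c).1 hc).nonempty_exactPairing
  let _ := BraidedCategory.exactPairing_swap ((ihom c).obj (𝟙_ C)) c
  exact ⟨_, (hC.compact_iff_rigid _).2 (isRigid_of_exactPairing c _), ⟨‹_›⟩, ⟨‹_›⟩⟩

section Detection

variable {C : Type u} [Category.{v} C] [Preadditive C] [HasShift C ℤ]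
  [∀ n : ℤ, (shiftFunctor C n).Additive]

lemma IsCompactObj.shift_s14 {c : C} (hc : IsCompactObj c) (n : ℤ) : IsCompactObj (c⟦n⟧) := by
  intro J
  obtain ⟨_⟩ := hc J
  let adj : shiftFunctor C n ⊣ shiftFunctor C (-n) := (shiftEquiv C n).toAdjunction
  let e : shiftFunctor C (-n) ⋙ preadditiveCoyoneda.obj (op c) ≅
      preadditiveCoyoneda.obj (op (c⟦n⟧)) :=
    NatIso.ofComponents (fun x => ((adj.homAddEquiv c x).symm).toAddCommGrpIso) (by
      intro x y f
      ext g
      exact adj.homEquiv_naturality_right_symm g f)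
  have : PreservesColimitsOfShape (Discrete J) (shiftFunctor C (-n)) :=
    inferInstanceAs (PreservesColimitsOfShape (Discrete J) (shiftEquiv C n).inverse)
  exact ⟨preservesColimitsOfShape_of_natIso e⟩

variable [HasZeroObject C] [Pretriangulated C] [MonoidalCategory C] [MonoidalClosed C]

lemma isIso_of_bijective_on_compacts
    (hC : RigidlyCompactlyGenerated C) {a b : C} (f : a ⟶ b)
    (h : ∀ c, IsCompactObj c → Function.Bijective fun g : c ⟶ a => g ≫ f) : IsIso f := by
  obtain ⟨z, v, w, hT⟩ := distinguished_cocone_triangle f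
  obtain ⟨ι, G, hG, hz⟩ := hC.exists_generators
  refine (Triangle.isZero₃_iff_isIso₁ _ hT).1 (hz z fun i g => ?_)
  have h₁₂ : f ≫ v = 0 := comp_distTriang_mor_zero₁₂ _ hT
  have h₃₁ : w ≫ f⟦(1 : ℤ)⟧' = 0 := comp_distTriang_mor_zero₃₁ _ hT
  have hw : g ≫ w = 0 := by
    let e := shiftNegShift (G i) (1 : ℤ)
    obtain ⟨u, hu⟩ := (shiftFunctor C (1 : ℤ)).map_surjective (e.hom ≫ g ≫ w)
    have hu' : u = 0 := by
      refine (h _ ((hG i).shift_s14 (-1))).1 ((shiftFunctor C (1 : ℤ)).map_injective ?_)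
      simp [hu, h₃₁]
    rw [hu', Functor.map_zero] at hu
    rw [← cancel_epi e.hom, ← hu, comp_zero]
  obtain ⟨g', hg'⟩ : ∃ g' : G i ⟶ b, g = g' ≫ v := Triangle.coyoneda_exact₃ _ hT g hw
  obtain ⟨g'', rfl⟩ := (h _ (hG i)).2 g'
  rw [hg', Category.assoc, h₁₂, comp_zero]

lemma leftDualAt_of_compact
    (hC : RigidlyCompactlyGenerated C) {x y k : C} (p : x ⊗ y ⟶ k)
    (h : ∀ c, IsCompactObj c → LeftDualAt p c) (t : C) : LeftDualAt p t :=
  (forall_leftDualAt_iff p).2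
    (isIso_of_bijective_on_compacts hC _ fun c hc => (leftDualAt_iff p c).1 (h c hc)) t

lemma rightDualAt_of_compact [BraidedCategory C]
    (hC : RigidlyCompactlyGenerated C) {x y k : C} (p : x ⊗ y ⟶ k)
    (h : ∀ c, IsCompactObj c → RightDualAt p c) (t : C) : RightDualAt p t := by
  simp only [rightDualAt_iff_leftDualAt_braiding] at h ⊢
  exact leftDualAt_of_compact hC _ h t

end Detection

/-- Theorem 5.21. -/
theorem statement14 {D : Type u₁} {C : Type u₂}
    [Category.{v} D] [Preadditive D] [HasZeroObject D] [HasShift D ℤ]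
    [∀ n : ℤ, (shiftFunctor D n).Additive] [Pretriangulated D] [IsTriangulated D]
    [MonoidalCategory D] [SymmetricCategory D] [MonoidalClosed D]
    [Category.{v} C] [Preadditive C] [HasZeroObject C] [HasShift C ℤ]
    [∀ n : ℤ, (shiftFunctor C n).Additive] [Pretriangulated C] [IsTriangulated C]
    [MonoidalCategory C] [SymmetricCategory C] [MonoidalClosed C]
    (fstar : D ⥤ C) [fstar.Braided] [fstar.CommShift ℤ] [fstar.IsTriangulated]
    (hD : RigidlyCompactlyGenerated D) (hC : RigidlyCompactlyGenerated C)
    (hcop : PreservesCoproducts fstar)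
    (fpush : C ⥤ D) (adj1 : fstar ⊣ fpush)
    (fone : D ⥤ C) (adj2 : fpush ⊣ fone)
    (D₀ : Set D) (hmod : IsSubmodule D₀) (κ : D) (hκ : IsDualizing D₀ κ) :
    -- (a)
    ((𝟙_ D) ∈ D₀ →
      ∀ x ∈ compactPullback fpush D₀, IsIso (varpi (fone.obj κ) x)) ∧
    -- (b)
    ((∀ x : D, x ∈ D₀ ↔ IsIso (varpi κ x)) →
      ∀ x : C, IsIso (varpi (fone.obj κ) x) → x ∈ compactPullback fpush D₀) := by
  have hpush {x y : C} (p : x ⊗ y ⟶ fone.obj κ) (hp : ∀ t, LeftDualAt p t) (t : D) :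
      LeftDualAt (pushPairing adj1 adj2 p) t := by
    refine leftDualAt_of_compact hD _ (fun d hd => ?_) t
    obtain ⟨d', -, -, ⟨_⟩⟩ := exists_exactPairing hD hd
    exact (leftDualAt_pushPairing_iff adj1 adj2 p d d').2 (hp _)
  have hcontract (x c' c : C) [ExactPairing c' c] (t : C) :
      LeftDualAt (contractPairing ((ihom.ev x).app (fone.obj κ)) c' c) t :=
    (leftDualAt_contractPairing_iff _ _ _ _).2 (leftDualAt_ev _ _ _)
  have hbraid (x c : C) : fpush.obj (c ⊗ x) ∈ D₀ ↔ fpush.obj (x ⊗ c) ∈ D₀ := by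
    have e := fpush.mapIso (β_ c x)
    exact ⟨hmod.retract _ _ ⟨e.inv, e.hom, e.inv_hom_id⟩,
      hmod.retract _ _ ⟨e.hom, e.inv, e.hom_inv_id⟩⟩
  refine ⟨fun _ x hx => ?_, fun hD₀ x hx c hc => ?_⟩
  · refine (isIso_varpi_iff _ (leftDualAt_ev x (fone.obj κ))).2
      (rightDualAt_of_compact hC _ fun c' hc' => ?_)
    obtain ⟨c, hc, -, ⟨_⟩⟩ := exists_exactPairing hC hc'
    have hdual := (isIso_varpi_iff _ (hpush _ (hcontract x c' c))).1
      (hκ.reflexive _ ((hbraid x c).1 (hx c hc))) (𝟙_ D)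
    rw [rightDualAt_pushPairing_iff adj1 adj2 _ (𝟙_ D) (𝟙_ D),
      rightDualAt_contractPairing_iff] at hdual
    exact hdual.of_iso (whiskerRightIso (Functor.Monoidal.εIso fstar).symm c' ≪≫ λ_ c')
  · obtain ⟨c', -, ⟨_⟩, -⟩ := exists_exactPairing hC hc
    rw [hbraid, hD₀, isIso_varpi_iff _ (hpush _ (hcontract x c' c))]
    refine rightDualAt_of_compact hD _ fun d hd => ?_
    obtain ⟨d', -, -, ⟨_⟩⟩ := exists_exactPairing hD hd
    rw [rightDualAt_pushPairing_iff adj1 adj2 _ d d', rightDualAt_contractPairing_iff]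
    exact (isIso_varpi_iff _ (leftDualAt_ev x (fone.obj κ))).1 hx _

end GN
end
end
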